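/- Let D be the following collection of subsets of {1,...,11}: {1,2}, {1,3,6}, {1,4,7}, {1,5,8}, {1,9,10,11}, {2,3,9}, {2,4,10}, {2,5,11}, {2,6,7,8}, {3,4,5}, {3,7}, {3,8,11}, {3,10}, {4,6,9}, {4,8}, {4,11}, {5,6}, {5,7,10}, {5,9}, {6,10}, {6,11}, {7,9}, {7,11}, {8,9}, {8,10}. Then the group of all permutations τ of {1,...,11} such that the image under τ of every member of D is again a member of D is exactly the subgroup of the symmetric group on {1,...,11} generated by the two permutations σ₁ = (3,4,5)(6,7,8)(9,10,11) and σ₂ = (1,2)(6,9)(7,10)(8,11). -/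

import Mathlib

/- The combinatorics `D` of the arrangements `N_i` (lines indexed by `Fin 11`,
line `Lk` corresponding to `(k-1 : Fin 11)`). -/
def D11 : Finset (Finset (Fin 11)) :=
  {{0, 1},
   {0, 2, 5},
   {0, 3, 6},
   {0, 4, 7},
   {0, 8, 9, 10},
   {1, 2, 8},
   {1, 3, 9},
   {1, 4, 10},
   {1, 5, 6, 7},
   {2, 3, 4},
   {2, 6},
   {2, 7, 10},
   {2, 9},
   {3, 5, 8},
   {3, 7},
   {3, 10},
   {4, 5},
   {4, 6, 9},
   {4, 8},
   {5, 9},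
   {5, 10},
   {6, 8},
   {6, 10},
   {7, 8},
   {7, 9}}

/-- The permutation `σ₁ = (3,4,5)(6,7,8)(9,10,11)` (in `Fin 11`, 0-indexed). -/
def σ₁ : Equiv.Perm (Fin 11) :=
  ⟨![0,1,3,4,2,6,7,5,9,10,8], ![0,1,4,2,3,7,5,6,10,8,9], by decide, by decide⟩

/-- The permutation `σ₂ = (1,2)(6,9)(7,10)(8,11)` (in `Fin 11`, 0-indexed). -/
def σ₂ : Equiv.Perm (Fin 11) :=
  ⟨![1,0,2,3,4,8,9,10,5,6,7], ![1,0,2,3,4,8,9,10,5,6,7], by decide, by decide⟩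

def DL : List (Finset (Fin 11)) :=
  [{0, 1},
   {0, 2, 5},
   {0, 3, 6},
   {0, 4, 7},
   {0, 8, 9, 10},
   {1, 2, 8},
   {1, 3, 9},
   {1, 4, 10},
   {1, 5, 6, 7},
   {2, 3, 4},
   {2, 6},
   {2, 7, 10},
   {2, 9},
   {3, 5, 8},
   {3, 7},
   {3, 10},
   {4, 5},
   {4, 6, 9},
   {4, 8},
   {5, 9},
   {5, 10},
   {6, 8},
   {6, 10},
   {7, 8},
   {7, 9}]

theorem mem_DL (s : Finset (Fin 11)) : s ∈ D11 ↔ s ∈ DL := by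
  simp only [D11, DL, Finset.mem_insert, Finset.mem_singleton, List.mem_cons, List.not_mem_nil, or_false]

def c2 (a b : Fin 11) : Bool :=
  ([3, 68, 516, 136, 1032, 48, 272, 544, 1056, 320, 1088, 384, 640] : List ℕ).elem (2 ^ a.val + 2 ^ b.val)

def c3 (a b c : Fin 11) : Bool :=
  ([37, 73, 145, 262, 522, 1042, 28, 1156, 296, 592] : List ℕ).elem (2 ^ a.val + 2 ^ b.val + 2 ^ c.val)

theorem code2 : ∀ s ∈ D11, s.card = 2 → (∑ i ∈ s, 2 ^ (Fin.val (n := 11) i)) ∈ ([3, 68, 516, 136, 1032, 48, 272, 544, 1056, 320, 1088, 384, 640] : List ℕ) := by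
  have h : DL.all (fun s => decide (s.card = 2 → (∑ i ∈ s, 2 ^ (Fin.val (n := 11) i)) ∈ ([3, 68, 516, 136, 1032, 48, 272, 544, 1056, 320, 1088, 384, 640] : List ℕ))) = true := by decide +kernel
  intro s hs
  have := List.all_eq_true.mp h s ((mem_DL s).mp hs)
  simpa only [decide_eq_true_eq, ← mem_DL] using this

theorem sum2 (f : Fin 11 → ℕ) (a b : Fin 11) (h : ({a, b} : Finset (Fin 11)).card = 2) :
    ∑ i ∈ ({a, b} : Finset (Fin 11)), f i = f a + f b := by
  have hab : a ≠ b := by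
    rintro rfl
    simp at h
  simp [hab]

theorem code3 : ∀ s ∈ D11, s.card = 3 → (∑ i ∈ s, 2 ^ (Fin.val (n := 11) i)) ∈ ([37, 73, 145, 262, 522, 1042, 28, 1156, 296, 592] : List ℕ) := by
  have h : DL.all (fun s => decide (s.card = 3 → (∑ i ∈ s, 2 ^ (Fin.val (n := 11) i)) ∈ ([37, 73, 145, 262, 522, 1042, 28, 1156, 296, 592] : List ℕ))) = true := by decide +kernel
  intro s hs
  have := List.all_eq_true.mp h s ((mem_DL s).mp hs)
  simpa only [decide_eq_true_eq, ← mem_DL] using this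

theorem sum3 (f : Fin 11 → ℕ) (a b c : Fin 11) (h : ({a, b, c} : Finset (Fin 11)).card = 3) :
    ∑ i ∈ ({a, b, c} : Finset (Fin 11)), f i = f a + f b + f c := by
  have hbc : ({b, c} : Finset (Fin 11)).card ≤ 2 := Finset.card_le_two
  have ha : a ∉ ({b, c} : Finset (Fin 11)) := by
    intro ha
    rw [Finset.insert_eq_of_mem ha] at h
    omega
  rw [Finset.card_insert_of_notMem ha] at h
  rw [Finset.sum_insert ha, sum2 f b c (by omega), add_assoc]

def G6 : List (List (Fin 11)) :=
  [[0, 1, 2, 3, 4, 5, 6, 7, 8, 9, 10],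
   [0, 1, 3, 4, 2, 6, 7, 5, 9, 10, 8],
   [0, 1, 4, 2, 3, 7, 5, 6, 10, 8, 9],
   [1, 0, 2, 3, 4, 8, 9, 10, 5, 6, 7],
   [1, 0, 3, 4, 2, 9, 10, 8, 6, 7, 5],
   [1, 0, 4, 2, 3, 10, 8, 9, 7, 5, 6]]

set_option synthInstance.maxSize 4000 in
set_option synthInstance.maxHeartbeats 400000 in
theorem search :
    ∀ x0 : Fin 11, 
    ∀ x1 : Fin 11, c2 x0 x1 = true → 
    ∀ x2 : Fin 11, 
    ∀ x5 : Fin 11, c3 x0 x2 x5 = true → 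
    ∀ x8 : Fin 11, c3 x1 x2 x8 = true → 
    ∀ x3 : Fin 11, c3 x3 x5 x8 = true → 
    ∀ x6 : Fin 11, c3 x0 x3 x6 = true → c2 x2 x6 = true → c2 x6 x8 = true → 
    ∀ x9 : Fin 11, c3 x1 x3 x9 = true → c2 x2 x9 = true → c2 x5 x9 = true → 
    ∀ x4 : Fin 11, c3 x2 x3 x4 = true → c2 x4 x5 = true → c3 x4 x6 x9 = true → c2 x4 x8 = true → 
    ∀ x7 : Fin 11, c3 x0 x4 x7 = true → c2 x3 x7 = true → c2 x7 x8 = true → c2 x7 x9 = true → 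
    ∀ x10 : Fin 11, c3 x1 x4 x10 = true → c3 x2 x7 x10 = true → c2 x3 x10 = true → c2 x5 x10 = true → c2 x6 x10 = true → 
    [x0, x1, x2, x3, x4, x5, x6, x7, x8, x9, x10] ∈ G6 := by
  decide +kernel

theorem gens_mem : ∀ s ∈ D11, Finset.image σ₁ s ∈ D11 ∧ Finset.image σ₂ s ∈ D11 := by
  have h : DL.all (fun s => decide (Finset.image σ₁ s ∈ DL ∧ Finset.image σ₂ s ∈ DL)) = true := by decide +kernel
  intro s hs
  have := List.all_eq_true.mp h s ((mem_DL s).mp hs)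
  simpa only [decide_eq_true_eq, ← mem_DL] using this

theorem inv_gens : (∀ s ∈ D11, s.image (σ₁⁻¹ : Equiv.Perm (Fin 11)) ∈ D11) ∧
    (∀ s ∈ D11, s.image (σ₂⁻¹ : Equiv.Perm (Fin 11)) ∈ D11) := by
  have e1 : σ₁⁻¹ = σ₁ * σ₁ := by decide +kernel
  have e2 : σ₂⁻¹ = σ₂ := by decide +kernel
  rw [e1, e2]
  refine ⟨fun s hs => ?_, fun s hs => (gens_mem s hs).2⟩
  have := (gens_mem _ (gens_mem s hs).1).1
  rwa [Finset.image_image] at this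

theorem perm_of_list : ∀ l ∈ G6, ∃ g ∈ ([1, σ₁, σ₁ * σ₁, σ₂, σ₁ * σ₂, σ₁ * σ₁ * σ₂] : List (Equiv.Perm (Fin 11))),
    l = List.ofFn g := by
  decide +kernel

theorem key_lemma (τ : Equiv.Perm (Fin 11)) (h : ∀ s ∈ D11, Finset.image τ s ∈ D11) :
    τ ∈ ([1, σ₁, σ₁ * σ₁, σ₂, σ₁ * σ₂, σ₁ * σ₁ * σ₂] : List (Equiv.Perm (Fin 11))) := by
  have h2 : ∀ a b : Fin 11, ({a, b} : Finset (Fin 11)) ∈ D11 → ({a, b} : Finset (Fin 11)).card = 2 →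
      c2 (τ a) (τ b) = true := by
    intro a b hs hc
    have h := code2 _ (h _ hs) (by rw [Finset.card_image_of_injective _ τ.injective, hc])
    rw [Finset.sum_image (fun x _ y _ e => τ.injective e), sum2 (fun x => 2 ^ (τ x).val) _ _ hc] at h
    simpa only [c2, List.elem_eq_mem, decide_eq_true_eq, add_assoc] using h
  have h3 : ∀ a b c : Fin 11, ({a, b, c} : Finset (Fin 11)) ∈ D11 → ({a, b, c} : Finset (Fin 11)).card = 3 →
      c3 (τ a) (τ b) (τ c) = true := by
    intro a b c hs hc
    have h := code3 _ (h _ hs) (by rw [Finset.card_image_of_injective _ τ.injective, hc])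
    rw [Finset.sum_image (fun x _ y _ e => τ.injective e), sum3 (fun x => 2 ^ (τ x).val) _ _ _ hc] at h
    simpa only [c3, List.elem_eq_mem, decide_eq_true_eq, add_assoc] using h
  have hl := search (τ 0) (τ 1) (h2 0 1 (by decide) (by decide)) (τ 2) (τ 5) (h3 0 2 5 (by decide) (by decide)) (τ 8) (h3 1 2 8 (by decide) (by decide)) (τ 3) (h3 3 5 8 (by decide) (by decide)) (τ 6) (h3 0 3 6 (by decide) (by decide)) (h2 2 6 (by decide) (by decide)) (h2 6 8 (by decide) (by decide)) (τ 9) (h3 1 3 9 (by decide) (by decide)) (h2 2 9 (by decide) (by decide)) (h2 5 9 (by decide) (by decide)) (τ 4) (h3 2 3 4 (by decide) (by decide)) (h2 4 5 (by decide) (by decide)) (h3 4 6 9 (by decide) (by decide)) (h2 4 8 (by decide) (by decide)) (τ 7) (h3 0 4 7 (by decide) (by decide)) (h2 3 7 (by decide) (by decide)) (h2 7 8 (by decide) (by decide)) (h2 7 9 (by decide) (by decide)) (τ 10) (h3 1 4 10 (by decide) (by decide)) (h3 2 7 10 (by decide) (by decide)) (h2 3 10 (by decide) (by decide)) (h2 5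 10 (by decide) (by decide)) (h2 6 10 (by decide) (by decide))
  obtain ⟨g, hg, e⟩ := perm_of_list _ hl
  have e2 : List.ofFn τ = List.ofFn g := by
    rw [← e]
    simp [List.ofFn_succ]
    try decide
  have : τ = g := Equiv.ext (fun x => congrFun (List.ofFn_injective e2) x)
  rw [this]
  exact hg

/-- The automorphism group of the combinatorics `D` is exactly the subgroup generated
by `σ₁ = (3,4,5)(6,7,8)(9,10,11)` and `σ₂ = (1,2)(6,9)(7,10)(8,11)`. -/
theorem statement7 :
    {τ : Equiv.Perm (Fin 11) | ∀ s ∈ D11, s.image τ ∈ D11}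
      = (Subgroup.closure {σ₁, σ₂} : Subgroup (Equiv.Perm (Fin 11))) := by
  have m1 : σ₁ ∈ Subgroup.closure {σ₁, σ₂} := Subgroup.subset_closure (by simp)
  have m2 : σ₂ ∈ Subgroup.closure {σ₁, σ₂} := Subgroup.subset_closure (by simp)
  ext τ
  simp only [Set.mem_ofPred_eq, SetLike.mem_coe]
  constructor
  · intro h
    have key : τ ∈ ([1, σ₁, σ₁ * σ₁, σ₂, σ₁ * σ₂, σ₁ * σ₁ * σ₂] : List (Equiv.Perm (Fin 11))) := by
      exact key_lemma τ h
    simp only [List.mem_cons, List.not_mem_nil, or_false] at key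
    rcases key with rfl | rfl | rfl | rfl | rfl | rfl
    · exact one_mem _
    · exact m1
    · exact mul_mem m1 m1
    · exact m2
    · exact mul_mem m1 m2
    · exact mul_mem (mul_mem m1 m1) m2
  · intro h
    induction h using Subgroup.closure_induction'' with
    | one => simp
    | mem x hx =>
      rcases hx with rfl | rfl
      · exact fun s hs => (gens_mem s hs).1
      · exact fun s hs => (gens_mem s hs).2
    | inv_mem x hx =>
      rcases hx with rfl | rfl
      · exact inv_gens.1
      · exact inv_gens.2
    | mul x y _ _ ihx ihy =>
      intro s hs
      have := ihx _ (ihy s hs)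
      rwa [Finset.image_image] at this
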